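/- Let T = {1,…,6} and let 𝓜₃ := {{(12,σ₁),(34,σ₂),(56,σ₃)} : σ₁,σ₂,σ₃ ∈ {odd, even}} be the set of PMPs on T pairing 1 with 2, 3 with 4, and 5 with 6. Then 𝓜₃ is not h-representable: there exist no positive integers N, k, nonnegative integers n_1,…,n_N, and vectors p^i, q^i ∈ ℤ^6 (i = 1,…,N) such that a PMP M on T belongs to 𝓜₃ if and only if Σ_{i=1}^N n_i Π_{(st,σ) ∈ M} [p^i,q^i]_{st,σ} ≢ 0 (mod 2^k). -/

import Mathlib

/-- A parity: `odd` or `even`. -/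
inductive Par : Type
  | odd : Par
  | even : Par
deriving DecidableEq

/-- The bracket `[p,q]_{st,σ}`: for a parity `σ` and an unordered pair `{s,t}`,
`[p,q]_{st,odd} = p_s p_t + q_s q_t` and `[p,q]_{st,even} = p_s q_t + q_s p_t`. -/
def brkt {n : ℕ} (p q : Fin n → ℤ) (σ : Par) : Sym2 (Fin n) → ℤ :=
  Sym2.lift ⟨fun s t =>
    match σ with
    | Par.odd => p s * p t + q s * q t
    | Par.even => p s * q t + q s * p t,
    by intro a b; cases σ <;> dsimp only <;> ring⟩

/-- A perfect matching with parity (PMP) on `{0, …, n−1}`: a set of pairs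
`(st, σ)` where the unordered pairs `st` are non-degenerate and partition the
index set, and `σ` is a parity. -/
def IsPMP {n : ℕ} (M : Finset (Sym2 (Fin n) × Par)) : Prop :=
  (∀ x ∈ M, ¬ x.1.IsDiag) ∧ ∀ i : Fin n, ∃! x, x ∈ M ∧ i ∈ x.1

/-- The product `Π_{(st,σ) ∈ M} [p,q]_{st,σ}`. -/
def pmpProd {n : ℕ} (p q : Fin n → ℤ) (M : Finset (Sym2 (Fin n) × Par)) : ℤ :=
  ∏ x ∈ M, brkt p q x.2 x.1

/-- Three pairs covering `Fin 6` form a perfect matching with parity. -/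
theorem isPMP_triple (a b c d e f : Fin 6) (σ₁ σ₂ σ₃ : Par)
    (h : [a, b, c, d, e, f].Nodup) :
    IsPMP {(s(a, b), σ₁), (s(c, d), σ₂), (s(e, f), σ₃)} := by
  have cover : [a, b, c, d, e, f].toFinset = Finset.univ :=
    Finset.eq_univ_of_card _ (by rw [List.toFinset_card_of_nodup h]; rfl)
  simp only [List.nodup_cons, List.mem_cons, List.not_mem_nil, or_false, not_or] at h
  refine ⟨by simp; grind, fun i => ?_⟩
  have hi : i ∈ [a, b, c, d, e, f].toFinset := cover ▸ Finset.mem_univ i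
  simp only [List.mem_toFinset, List.mem_cons, List.not_mem_nil, or_false] at hi
  obtain hi | hi | hi : (i = a ∨ i = b) ∨ (i = c ∨ i = d) ∨ (i = e ∨ i = f) := by tauto
  · exact ⟨(s(a, b), σ₁), by simp [hi], by simp; grind⟩
  · exact ⟨(s(c, d), σ₂), by simp [hi], by simp; grind⟩
  · exact ⟨(s(e, f), σ₃), by simp [hi], by simp; grind⟩

/-- The product over a matching with three pairs, written out. -/
theorem pmpProd_triple (p q : Fin 6 → ℤ) (a b c d e f : Fin 6) (σ₁ σ₂ σ₃ : Par)
    (h : [a, b, c, d, e, f].Nodup) :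
    pmpProd p q {(s(a, b), σ₁), (s(c, d), σ₂), (s(e, f), σ₃)} =
      brkt p q σ₁ s(a, b) * brkt p q σ₂ s(c, d) * brkt p q σ₃ s(e, f) := by
  simp only [List.nodup_cons, List.mem_cons, List.not_mem_nil, or_false, not_or] at h
  rw [pmpProd, Finset.prod_insert (by simp; grind), Finset.prod_insert (by simp; grind),
    Finset.prod_singleton, mul_assoc]

/-- The value of the all-odd matching `12|34|56` is an integral combination of values of
matchings with other underlying pairs. -/
theorem pmpProd_odd_eq (p q : Fin 6 → ℤ) :
    pmpProd p q {(s(0, 1), Par.odd), (s(2, 3), Par.odd), (s(4, 5), Par.odd)} =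
      pmpProd p q {(s(0, 1), Par.odd), (s(2, 4), Par.odd), (s(3, 5), Par.odd)} -
      pmpProd p q {(s(0, 5), Par.even), (s(1, 3), Par.even), (s(2, 4), Par.odd)} +
      pmpProd p q {(s(0, 2), Par.even), (s(1, 4), Par.odd), (s(3, 5), Par.even)} -
      pmpProd p q {(s(0, 2), Par.even), (s(1, 3), Par.odd), (s(4, 5), Par.even)} +
      pmpProd p q {(s(0, 5), Par.even), (s(1, 4), Par.even), (s(2, 3), Par.odd)} := by
  repeat rw [pmpProd_triple _ _ _ _ _ _ _ _ _ _ _ (by decide)]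
  simp only [brkt, Sym2.lift_mk]
  ring

/-- For `T = {1,…,6}` (encoded as `Fin 6`), the set
`𝓜₃ = {{(12,σ₁),(34,σ₂),(56,σ₃)} : σ₁,σ₂,σ₃ ∈ {odd,even}}` of PMPs pairing `1`
with `2`, `3` with `4`, and `5` with `6` is not h-representable: there are no
positive integers `N, k`, nonnegative integers `n₁,…,n_N`, and vectors
`pⁱ, qⁱ ∈ ℤ⁶` such that a PMP `M` belongs to `𝓜₃` iff
`Σ_{i=1}^N n_i Π_{(st,σ) ∈ M} [pⁱ,qⁱ]_{st,σ} ≢ 0 (mod 2^k)`. -/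
theorem M3_not_h_representable :
    ¬ ∃ (N k : ℕ), 0 < N ∧ 0 < k ∧
      ∃ (n : Fin N → ℕ) (p q : Fin N → Fin 6 → ℤ),
        ∀ M : Finset (Sym2 (Fin 6) × Par), IsPMP M →
          ((∃ σ₁ σ₂ σ₃ : Par,
              M = {(s(0, 1), σ₁), (s(2, 3), σ₂), (s(4, 5), σ₃)}) ↔
            ¬ ((2 : ℤ) ^ k ∣ ∑ i : Fin N, (n i : ℤ) * pmpProd (p i) (q i) M)) := by
  rintro ⟨N, k, -, -, n, p, q, h⟩
  have outside : ∀ (a b c d e f : Fin 6) (σ₁ σ₂ σ₃ : Par), [a, b, c, d, e, f].Nodup →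
      s(c, d) ∉ ({s(0, 1), s(2, 3), s(4, 5)} : Finset (Sym2 (Fin 6))) →
      (2 : ℤ) ^ k ∣ ∑ i : Fin N, (n i : ℤ) *
        pmpProd (p i) (q i) {(s(a, b), σ₁), (s(c, d), σ₂), (s(e, f), σ₃)} := by
    intro a b c d e f σ₁ σ₂ σ₃ hnodup hcd
    by_contra hdvd
    obtain ⟨τ₁, τ₂, τ₃, hM⟩ := (h _ (isPMP_triple a b c d e f σ₁ σ₂ σ₃ hnodup)).mpr hdvd
    apply hcd
    have hmem : (s(c, d), σ₂) ∈ ({(s(0, 1), τ₁), (s(2, 3), τ₂), (s(4, 5), τ₃)} :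
        Finset (Sym2 (Fin 6) × Par)) := hM ▸ by simp
    simp only [Finset.mem_insert, Finset.mem_singleton, Prod.mk.injEq] at hmem ⊢
    tauto
  refine (h _ (isPMP_triple 0 1 2 3 4 5 _ _ _ (by decide))).mp
    ⟨Par.odd, Par.odd, Par.odd, rfl⟩ ?_
  simp only [pmpProd_odd_eq, mul_add, mul_sub, Finset.sum_add_distrib, Finset.sum_sub_distrib]
  refine dvd_add (dvd_sub (dvd_add (dvd_sub ?_ ?_) ?_) ?_) ?_ <;>
    exact outside _ _ _ _ _ _ _ _ _ (by decide) (by decide)
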